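/- Assume (H1), (H2) and (H3′): α̲_0(x̄) > −t for H^t-almost every x̄ ∈ Γ. Then there exists a linear operator T from N^{s,p}(Ω) to the space of Borel-measurable real functions on Γ with the following property: for each u ∈ N^{s,p}(Ω) there is a Borel set Γ′ ⊆ Γ with H^t(Γ ∖ Γ′) = 0 such that for every x̄ ∈ Γ′ and every 0 < λ < 1, g(x;u) → Tu(x̄) as x → x̄ with x ∈ Q_λ(x̄). Moreover, for every x̄ ∈ Γ′ and every 0 < β < (α̲_0(x̄) + t)/p there exists δ_β = δ_β(x̄) > 0 such that for each 0 < λ < 1 there is a constant C_{β,λ}(x̄) < ∞ with |Tu(x̄) − g(x;u)| ≤ C_{β,λ}(x̄) · ‖x̄ − x‖^β for all x ∈ Q_{λ,δ_β}(x̄). -/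

import Mathlib

open MeasureTheory Metric Set Filter
open scoped ENNReal NNReal Topology

noncomputable section

abbrev Euc (n : ℕ) := EuclideanSpace ℝ (Fin n)

variable {n : ℕ}

/-- Distance to the boundary of `Ω`. -/
def dB (Ω : Set (Euc n)) (x : Euc n) : ℝ := infDist x (frontier Ω)

/-- `Ψ(x) = B(x, d(x)/2)`. -/
def PsiB (Ω : Set (Euc n)) (x : Euc n) : Set (Euc n) := ball x (dB Ω x / 2)

/-- `Φ(x) = B(x, d(x)/6)`. -/
def PhiB (Ω : Set (Euc n)) (x : Euc n) : Set (Euc n) := ball x (dB Ω x / 6)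

/-- The integrand of `ν(·;u)`. -/
def nuInt (Ω : Set (Euc n)) (s : Euc n → ℝ) (p : ℝ) (u : Euc n → ℝ) (x : Euc n) : ℝ :=
  (⨍ y in PsiB Ω x, |u y - u x|) ^ p * dB Ω x ^ (-(p * s x))

/-- `ν(E;u)`. -/
def nuM (Ω : Set (Euc n)) (s : Euc n → ℝ) (p : ℝ) (u : Euc n → ℝ) (E : Set (Euc n)) : ℝ :=
  ∫ x in Ω ∩ E, nuInt Ω s p u x

/-- Membership in the nonlocal space `𝒩^{s,p}(Ω)`: `u ∈ L¹(Ω)` and `ν(Ω;u) < ∞`. -/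
def MemN (Ω : Set (Euc n)) (s : Euc n → ℝ) (p : ℝ) (u : Euc n → ℝ) : Prop :=
  IntegrableOn u Ω volume ∧ IntegrableOn (nuInt Ω s p u) Ω volume

/-- `g(x;u)`, the mean of `u` over `Φ(x)`. -/
def gFun (Ω : Set (Euc n)) (u : Euc n → ℝ) (x : Euc n) : ℝ := ⨍ y in PhiB Ω x, u y

/-- The approach region `Q^θ_λ(xb)`. -/
def Qreg (Ω : Set (Euc n)) (lam θ : ℝ) (xb : Euc n) : Set (Euc n) :=
  {x | x ∈ Ω ∧ (lam * dist xb x) ^ θ < dB Ω x}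

/-- `Q` is an `(η,θ)`-corkscrew region for `xb` with radius `δ₀`. -/
def IsCorkscrew (Ω Q : Set (Euc n)) (xb : Euc n) (η θ δ₀ : ℝ) : Prop :=
  ∀ δ : ℝ, 0 < δ → δ ≤ δ₀ →
    ∃ x ∈ Q, η * δ < dist xb x ∧ dist xb x < δ ∧ (η * δ) ^ θ < dB Ω x

/-- `E` is `(C,θ)`-connected to `xb`, with radius `ρ₀` and gauge `ε`. -/
def ConnectedTo (Ω E : Set (Euc n)) (xb : Euc n) (C θ ρ₀ : ℝ) (ε : ℝ → ℝ) : Prop :=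
  ∀ lam : ℝ, 0 < lam → lam < 1 →
    0 < ε lam ∧ ε lam ≤ lam ∧
      ∀ ρ : ℝ, 0 < ρ → ρ ≤ ρ₀ → ∀ x ∈ E ∩ ball xb ρ, ∀ x' ∈ E ∩ ball xb ρ,
        (lam * ρ) ^ θ ≤ dB Ω x → (lam * ρ) ^ θ ≤ dB Ω x' →
        ∃ γ : ℝ → Euc n, ContinuousOn γ (Icc 0 1) ∧ γ 0 = x ∧ γ 1 = x' ∧
          (∀ τ ∈ Icc (0:ℝ) 1, γ τ ∈ E ∧ ε lam * ρ ^ θ ≤ dB Ω (γ τ)) ∧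
          eVariationOn γ (Icc 0 1) ≤ ENNReal.ofReal (C * ρ)

/-- The piecewise bilinear function `α(s,θ)`. -/
def alphaFun (n : ℕ) (p sv θ : ℝ) : ℝ :=
  if p * sv - n ≤ p - 1 then p * (1 - θ) + (p * sv - n) * θ
  else (1 - θ) + (p * sv - n)

/-- `s̲_δ(xb)`. -/
def sLow (Ω : Set (Euc n)) (s : Euc n → ℝ) (xb : Euc n) (δ : ℝ) : ℝ :=
  sInf (s '' (Ω ∩ ball xb δ))

/-- `α̲_δ(xb)`. -/
def alphaLow (Ω : Set (Euc n)) (s : Euc n → ℝ) (p : ℝ) (θΓ : Euc n → ℝ)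
    (xb : Euc n) (δ : ℝ) : ℝ :=
  alphaFun n p (sLow Ω s xb δ) (θΓ xb)

/-- `α̲_0(xb) = lim_{δ → 0⁺} α̲_δ(xb)`. -/
def alphaLow0 (Ω : Set (Euc n)) (s : Euc n → ℝ) (p : ℝ) (θΓ : Euc n → ℝ) (xb : Euc n) : ℝ :=
  limUnder (𝓝[>] (0:ℝ)) (fun δ => alphaLow Ω s p θΓ xb δ)

/-- `Γ_τ`: points of `Γ` where `limsup_{ρ→0⁺} ρ^{-τ} ν(B(xb,ρ);u) < ∞`. -/
def GammaTau (Ω : Set (Euc n)) (s : Euc n → ℝ) (p : ℝ) (u : Euc n → ℝ)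
    (Γ : Set (Euc n)) (τ : ℝ) : Set (Euc n) :=
  {xb ∈ Γ | ∃ M : ℝ, ∀ᶠ ρ in 𝓝[>] (0:ℝ), ρ ^ (-τ) * nuM Ω s p u (ball xb ρ) ≤ M}

/-- `M_τ(xb) = sup_{0<ρ≤δΓ} ρ^{-τ} ν(B(xb,ρ);u)`. -/
def Mtau (Ω : Set (Euc n)) (s : Euc n → ℝ) (p : ℝ) (u : Euc n → ℝ)
    (δΓ τ : ℝ) (xb : Euc n) : ℝ :=
  sSup ((fun ρ => ρ ^ (-τ) * nuM Ω s p u (ball xb ρ)) '' Ioc 0 δΓ)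


lemma dB_pos {Ω : Set (Euc n)} (hΩo : IsOpen Ω) (hfr : (frontier Ω).Nonempty) {x : Euc n}
    (hx : x ∈ Ω) : 0 < dB Ω x := by
  unfold dB
  rw [← infDist_pos_iff_notMem_closure hfr |>.symm.symm, isClosed_frontier.closure_eq, hΩo.frontier_eq]
  exact fun h => h.2 hx

lemma ball_dB_subset {Ω : Set (Euc n)} (hΩo : IsOpen Ω) {x : Euc n}
    (hx : x ∈ Ω) : ball x (dB Ω x) ⊆ Ω := by
  intro y hy
  have hpos : 0 < dB Ω x := dist_nonneg.trans_lt (mem_ball.1 hy)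
  have hconn : IsPreconnected (ball x (dB Ω x)) := (convex_ball x _).isPreconnected
  by_contra hyn
  have hcl : y ∉ closure Ω := by
    intro hc
    have : y ∈ frontier Ω := by rw [hΩo.frontier_eq]; exact ⟨hc, hyn⟩
    have h1 : infDist x (frontier Ω) ≤ dist x y := infDist_le_dist_of_mem this
    rw [mem_ball, dist_comm] at hy
    unfold dB at hy
    linarith
  have := hconn Ω (closure Ω)ᶜ hΩo isClosed_closure.isOpen_compl ?_
    ⟨x, mem_ball_self hpos, hx⟩ ⟨y, hy, hcl⟩
  · obtain ⟨z, -, hz1, hz2⟩ := this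
    exact hz2 (subset_closure hz1)
  · intro z hz
    by_contra hzn
    simp only [mem_union, mem_compl_iff, not_or, not_not] at hzn
    have : z ∈ frontier Ω := by rw [hΩo.frontier_eq]; exact ⟨hzn.2, hzn.1⟩
    have h1 : infDist x (frontier Ω) ≤ dist x z := infDist_le_dist_of_mem this
    rw [mem_ball, dist_comm] at hz
    unfold dB at hz
    linarith

lemma dB_le_add (Ω : Set (Euc n)) (x y : Euc n) : dB Ω x ≤ dB Ω y + dist x y :=
  infDist_le_infDist_add_dist

lemma dB_le_dist {Ω : Set (Euc n)} {xb : Euc n} (h : xb ∈ frontier Ω) (x : Euc n) :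
    dB Ω x ≤ dist x xb := infDist_le_dist_of_mem h

lemma dB_nonneg (Ω : Set (Euc n)) (x : Euc n) : 0 ≤ dB Ω x := infDist_nonneg

lemma vol_ball (x : Euc n) {r : ℝ} (hr : 0 < r) :
    volume.real (ball x r) = r ^ n * volume.real (ball (0 : Euc n) 1) := by
  rw [measureReal_def, Measure.addHaar_ball_of_pos _ _ hr]
  simp [measureReal_def, hr.le]

lemma vol_unit_pos (n : ℕ) : 0 < volume.real (ball (0 : Euc n) 1) :=
  ENNReal.toReal_pos (measure_ball_pos volume _ one_pos).ne' measure_ball_lt_top.ne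

/-- mean over a sub-ball compared with the centre value. -/
lemma avg_sub_le {u : Euc n → ℝ} {w y : Euc n} {r R : ℝ} (hr : 0 < r) (hR : R ≤ 4 * r)
    (hsub : ball w r ⊆ ball y R) (hu : IntegrableOn u (ball y R)) :
    |(⨍ z in ball w r, u z) - u y| ≤ 4 ^ n * ⨍ z in ball y R, |u z - u y| := by
  have hR0 : 0 < R := dist_nonneg.trans_lt (mem_ball.1 (hsub (mem_ball_self hr)))
  have hω := vol_unit_pos n
  have hvr : 0 < volume.real (ball w r) := by rw [vol_ball w hr]; positivity
  have hvR : 0 < volume.real (ball y R) := by rw [vol_ball y hR0]; positivity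
  have hIntg : IntegrableOn (fun z => |u z - u y|) (ball y R) := by
    apply Integrable.abs
    exact hu.sub (integrableOn_const measure_ball_lt_top.ne)
  have h1 : (⨍ z in ball w r, u z) - u y = ⨍ z in ball w r, (u z - u y) := by
    rw [setAverage_eq, setAverage_eq, integral_sub (hu.mono_set hsub)
      (integrableOn_const measure_ball_lt_top.ne)]
    simp only [setIntegral_const, smul_eq_mul]
    field_simp
  rw [h1, setAverage_eq, setAverage_eq, smul_eq_mul, smul_eq_mul, abs_mul,
    abs_of_pos (inv_pos.2 hvr)]
  have h2 : |∫ z in ball w r, (u z - u y)| ≤ ∫ z in ball y R, |u z - u y| := by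
    refine (abs_integral_le_integral_abs).trans ?_
    exact setIntegral_mono_set hIntg (Eventually.of_forall fun _ => abs_nonneg _)
      (Eventually.of_forall hsub)
  have h3 : (volume.real (ball w r))⁻¹ ≤ 4 ^ n * (volume.real (ball y R))⁻¹ := by
    rw [← div_eq_mul_inv, inv_eq_one_div, div_le_div_iff₀ hvr hvR, vol_ball w hr,
      vol_ball y hR0, one_mul, ← mul_assoc, ← mul_pow]
    gcongr
  calc _ ≤ (4 ^ n * (volume.real (ball y R))⁻¹) * ∫ z in ball y R, |u z - u y| := by
        gcongr
    _ = _ := by ring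

lemma gstep {Ω : Set (Euc n)} (hΩo : IsOpen Ω) (hfr : (frontier Ω).Nonempty) {u : Euc n → ℝ}
    (hu : IntegrableOn u Ω) {x x' y : Euc n} (hx : x ∈ Ω) 
    (hxx : dist x x' ≤ dB Ω x / 14) (hy : y ∈ PhiB Ω x) :
    |gFun Ω u x - gFun Ω u x'| ≤ 2 * 4 ^ n * ⨍ z in PsiB Ω y, |u z - u y| := by
  have hd := dB_pos hΩo hfr hx
  unfold PhiB at hy
  rw [mem_ball] at hy
  have hyΩ : y ∈ Ω := ball_dB_subset hΩo hx (by rw [mem_ball]; linarith)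
  have hy1 := dB_le_add Ω x y
  have hy2 := dB_le_add Ω y x
  have hx1 := dB_le_add Ω x x'
  have hx2 := dB_le_add Ω x' x
  rw [dist_comm] at hy1
  rw [dist_comm] at hx2
  have hPs : PsiB Ω y ⊆ Ω := by
    refine Subset.trans (ball_subset_ball ?_) (ball_dB_subset hΩo hyΩ)
    have := dB_nonneg Ω y
    linarith
  have huP : IntegrableOn u (ball y (dB Ω y / 2)) := hu.mono_set hPs
  have e1 := avg_sub_le (u := u) (w := x) (y := y) (r := dB Ω x / 6) (R := dB Ω y / 2)
    (by linarith) (by linarith) (ball_subset_ball' (by rw [dist_comm]; linarith)) huP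
  have e2 := avg_sub_le (u := u) (w := x') (y := y) (r := dB Ω x' / 6) (R := dB Ω y / 2)
    (by linarith) (by linarith) (ball_subset_ball' (by
      have := dist_triangle x' x y
      rw [dist_comm x' x, dist_comm x y] at this
      linarith)) huP
  have h3 : gFun Ω u x - gFun Ω u x' = (gFun Ω u x - u y) - (gFun Ω u x' - u y) := by ring
  rw [h3]
  refine (abs_sub _ _).trans ?_
  unfold gFun PhiB PsiB
  linarith

lemma nuInt_nonneg (Ω : Set (Euc n)) (s : Euc n → ℝ) (p : ℝ) (u : Euc n → ℝ) (x : Euc n) :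
    0 ≤ nuInt Ω s p u x := by
  unfold nuInt
  have h1 : 0 ≤ ⨍ y in PsiB Ω x, |u y - u x| := by
    rw [setAverage_eq, smul_eq_mul]
    exact mul_nonneg (inv_nonneg.2 measureReal_nonneg) (integral_nonneg fun _ => abs_nonneg _)
  exact mul_nonneg (Real.rpow_nonneg h1 _) (Real.rpow_nonneg (dB_nonneg _ _) _)

lemma nuM_nonneg (Ω : Set (Euc n)) (s : Euc n → ℝ) (p : ℝ) (u : Euc n → ℝ) (E : Set (Euc n)) :
    0 ≤ nuM Ω s p u E := integral_nonneg fun _ => nuInt_nonneg _ _ _ _ _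

lemma pstep {p sl : ℝ} (hp : 1 ≤ p) (hsl : 0 ≤ sl) (n : ℕ) :
    ∃ K : ℝ, 0 ≤ K ∧ ∀ (Ω : Set (Euc n)) (s : Euc n → ℝ) (u : Euc n → ℝ) (B : Set (Euc n))
      (x x' : Euc n), IsOpen Ω → (frontier Ω).Nonempty → MemN Ω s p u → x ∈ Ω →
      dist x x' ≤ dB Ω x / 14 → PhiB Ω x ⊆ B →
      (∀ y ∈ PhiB Ω x, sl ≤ s y ∧ dB Ω y ≤ 1) →
      |gFun Ω u x - gFun Ω u x'| ≤ K * dB Ω x ^ (sl - n / p) * nuM Ω s p u B ^ (1 / p) := by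
  have hp0 : 0 < p := by linarith
  have hω := vol_unit_pos n
  set ω := volume.real (ball (0 : Euc n) 1) with hωd
  set K1 : ℝ := (2 * 4 ^ n) ^ p * (7 / 6) ^ (p * sl) * 6 ^ n / ω with hK1
  have hK1p : 0 < K1 := by positivity
  refine ⟨K1 ^ (1 / p), by positivity, ?_⟩
  intro Ω s u B x x' hΩo hfr hu hx hxx hB hs
  have hd := dB_pos hΩo hfr hx
  set d := dB Ω x with hdd
  set Δ := |gFun Ω u x - gFun Ω u x'| with hΔ
  have hΔ0 : 0 ≤ Δ := abs_nonneg _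
  have hPhi : PhiB Ω x ⊆ Ω :=
    (ball_subset_ball (by rw [← hdd]; linarith)).trans (ball_dB_subset hΩo hx)
  -- pointwise bound
  have hpt : ∀ y ∈ PhiB Ω x,
      Δ ^ p * (7 / 6 * d) ^ (-(p * sl)) ≤ (2 * 4 ^ n) ^ p * nuInt Ω s p u y := by
    intro y hy
    have h1 := gstep hΩo hfr hu.1 hx hxx hy
    have hyd := dB_pos hΩo hfr (hPhi hy)
    have hy2 := dB_le_add Ω y x
    have hy3 : dist y x < d / 6 := mem_ball.1 hy
    have hA : 0 ≤ ⨍ z in PsiB Ω y, |u z - u y| := by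
      rw [setAverage_eq, smul_eq_mul]
      exact mul_nonneg (inv_nonneg.2 measureReal_nonneg) (integral_nonneg fun _ => abs_nonneg _)
    have h2 : Δ ^ p ≤ (2 * 4 ^ n) ^ p * (⨍ z in PsiB Ω y, |u z - u y|) ^ p := by
      rw [← Real.mul_rpow (by positivity) hA]
      exact Real.rpow_le_rpow hΔ0 h1 hp0.le
    have h3 : (7 / 6 * d) ^ (-(p * sl)) ≤ dB Ω y ^ (-(p * s y)) := by
      calc (7 / 6 * d) ^ (-(p * sl)) ≤ dB Ω y ^ (-(p * sl)) :=
            Real.rpow_le_rpow_of_nonpos hyd (by linarith) (by nlinarith)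
        _ ≤ dB Ω y ^ (-(p * s y)) := by
            apply Real.rpow_le_rpow_of_exponent_ge hyd (hs y hy).2
            have := (hs y hy).1
            nlinarith
    unfold nuInt
    calc _ ≤ ((2 * 4 ^ n) ^ p * (⨍ z in PsiB Ω y, |u z - u y|) ^ p) * dB Ω y ^ (-(p * s y)) := by
          gcongr
      _ = _ := by ring
  have hIntg : IntegrableOn (nuInt Ω s p u) (PhiB Ω x) := hu.2.mono_set hPhi
  have hvol : volume.real (PhiB Ω x) = (d / 6) ^ n * ω := vol_ball x (by linarith)
  have hI : volume.real (PhiB Ω x) * (Δ ^ p * (7 / 6 * d) ^ (-(p * sl)))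
      ≤ (2 * 4 ^ n) ^ p * nuM Ω s p u B := by
    calc _ = ∫ y in PhiB Ω x, Δ ^ p * (7 / 6 * d) ^ (-(p * sl)) := by simp
      _ ≤ ∫ y in PhiB Ω x, (2 * 4 ^ n) ^ p * nuInt Ω s p u y := by
          apply setIntegral_mono_on (integrableOn_const measure_ball_lt_top.ne)
            (hIntg.const_mul _) measurableSet_ball hpt
      _ = (2 * 4 ^ n) ^ p * ∫ y in PhiB Ω x, nuInt Ω s p u y := by
          rw [integral_const_mul]
      _ ≤ _ := by
          gcongr
          exact setIntegral_mono_set (hu.2.mono_set inter_subset_left)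
            (Eventually.of_forall fun _ => nuInt_nonneg _ _ _ _ _)
            (Eventually.of_forall fun y hy => ⟨hPhi hy, hB hy⟩)
  have hν := nuM_nonneg Ω s p u B
  have hfin : Δ ^ p ≤ K1 * d ^ (p * sl - n) * nuM Ω s p u B := by
    rw [hvol, Real.mul_rpow (by norm_num) hd.le, Real.rpow_neg (by norm_num), Real.rpow_neg hd.le]
      at hI
    rw [hK1, Real.rpow_sub hd, Real.rpow_natCast]
    have hq : 0 < (7 / 6 : ℝ) ^ (p * sl) := by positivity
    have hdq : 0 < d ^ (p * sl) := by positivity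
    have hdn : 0 < d ^ n := by positivity
    have : Δ ^ p = (d / 6) ^ n * ω * (Δ ^ p * (((7 / 6 : ℝ) ^ (p * sl))⁻¹ * (d ^ (p * sl))⁻¹)) *
        ((7 / 6 : ℝ) ^ (p * sl) * d ^ (p * sl) * 6 ^ n / (d ^ n * ω)) := by
      rw [div_pow]
      field_simp
    rw [this]
    refine (mul_le_mul_of_nonneg_right hI (by positivity)).trans (le_of_eq ?_)
    field_simp
  have := Real.rpow_le_rpow (by positivity) hfin (by positivity : 0 ≤ 1 / p)
  rw [← Real.rpow_mul hΔ0, mul_one_div_cancel hp0.ne', Real.rpow_one,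
    Real.mul_rpow (by positivity) hν, Real.mul_rpow hK1p.le (by positivity),
    ← Real.rpow_mul hd.le] at this
  convert this using 4
  field_simp

lemma chain {F D : ℝ → ℝ} {γ : ℝ → Euc n} {K R D0 c : ℝ} (hc : 0 < c) (hD0 : 0 < D0)
    (hK : 0 ≤ K) (hγ : ContinuousOn γ (Icc 0 1))
    (hfin : eVariationOn γ (Icc 0 1) ≠ ⊤)
    (hD : ∀ τ ∈ Icc (0:ℝ) 1, D0 ≤ D τ ∧ D τ ≤ R)
    (hstep : ∀ τ ∈ Icc (0:ℝ) 1, ∀ τ' ∈ Icc (0:ℝ) 1, dist (γ τ) (γ τ') ≤ c * D τ →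
      |F τ - F τ'| ≤ K * D τ) :
    |F 0 - F 1| ≤ K * ((eVariationOn γ (Icc 0 1)).toReal / c + R) := by
  have hft : ∀ τ ∈ Icc (0:ℝ) 1, eVariationOn γ (Icc τ 1) ≠ ⊤ := fun τ hτ =>
    ne_top_of_le_ne_top hfin (eVariationOn.mono _ (Icc_subset_Icc hτ.1 le_rfl))
  have key : ∀ m : ℕ, ∀ τ ∈ Icc (0:ℝ) 1, (eVariationOn γ (Icc τ 1)).toReal ≤ m * (c * D0) →
      |F τ - F 1| ≤ K * ((eVariationOn γ (Icc τ 1)).toReal / c + R) := by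
    intro m
    induction m with
    | zero =>
      intro τ hτ hV
      have h1 := eVariationOn.edist_le γ (s := Icc τ 1) (left_mem_Icc.2 hτ.2) (right_mem_Icc.2 hτ.2)
      have h2 : dist (γ τ) (γ 1) ≤ (eVariationOn γ (Icc τ 1)).toReal := by
        rw [dist_edist]; exact ENNReal.toReal_mono (hft τ hτ) h1
      have hDτ := hD τ hτ
      have h3 := hstep τ hτ 1 (right_mem_Icc.2 zero_le_one) (by
        push_cast at hV
        have : 0 ≤ c * D τ := mul_nonneg hc.le (by linarith)
        linarith)
      refine h3.trans (mul_le_mul_of_nonneg_left ?_ hK)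
      have : 0 ≤ (eVariationOn γ (Icc τ 1)).toReal / c := by positivity
      linarith
    | succ m ih =>
      intro τ hτ hV
      have hDτ := hD τ hτ
      by_cases hcase : dist (γ τ) (γ 1) ≤ c * D τ
      · have h3 := hstep τ hτ 1 (right_mem_Icc.2 zero_le_one) hcase
        refine h3.trans (mul_le_mul_of_nonneg_left ?_ hK)
        have : 0 ≤ (eVariationOn γ (Icc τ 1)).toReal / c := by positivity
        linarith
      · push Not at hcase
        have hcont : ContinuousOn (fun σ => dist (γ τ) (γ σ)) (Icc τ 1) :=
          (continuous_const.dist continuous_id).comp_continuousOn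
            (hγ.mono (Icc_subset_Icc hτ.1 le_rfl))
        obtain ⟨σ, hσ, hσe⟩ := intermediate_value_Icc hτ.2 hcont
          (show c * D τ ∈ Icc _ _ from ⟨by simp; exact mul_nonneg hc.le (by linarith), hcase.le⟩)
        have hσ01 : σ ∈ Icc (0:ℝ) 1 := ⟨hτ.1.trans hσ.1, hσ.2⟩
        simp only at hσe
        have hadd : eVariationOn γ (Icc τ σ) + eVariationOn γ (Icc σ 1) =
            eVariationOn γ (Icc τ 1) := by
          have := eVariationOn.Icc_add_Icc γ (s := univ) hσ.1 hσ.2 (mem_univ _)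
          simpa using this
        have hft1 : eVariationOn γ (Icc τ σ) ≠ ⊤ :=
          ne_top_of_le_ne_top (hft τ hτ) (eVariationOn.mono _ (Icc_subset_Icc le_rfl hσ.2))
        have hadd' : (eVariationOn γ (Icc τ σ)).toReal + (eVariationOn γ (Icc σ 1)).toReal =
            (eVariationOn γ (Icc τ 1)).toReal := by
          rw [← ENNReal.toReal_add hft1 (hft σ hσ01), hadd]
        have h2 : c * D τ ≤ (eVariationOn γ (Icc τ σ)).toReal := by
          rw [← hσe, dist_edist]
          exact ENNReal.toReal_mono hft1
            (eVariationOn.edist_le γ (left_mem_Icc.2 hσ.1) (right_mem_Icc.2 hσ.1))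
        have h3 := hstep τ hτ σ hσ01 hσe.le
        have h4 := ih σ hσ01 (by
          push_cast at hV
          have : c * D0 ≤ c * D τ := mul_le_mul_of_nonneg_left hDτ.1 hc.le
          linarith)
        have h5 : D τ ≤ (eVariationOn γ (Icc τ σ)).toReal / c := by
          rw [le_div_iff₀ hc]; linarith
        calc |F τ - F 1| ≤ |F τ - F σ| + |F σ - F 1| := abs_sub_le _ _ _
          _ ≤ K * ((eVariationOn γ (Icc τ σ)).toReal / c) +
              K * ((eVariationOn γ (Icc σ 1)).toReal / c + R) := by
              gcongr
              exact h3.trans (mul_le_mul_of_nonneg_left h5 hK)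
          _ = _ := by rw [← hadd']; ring
  obtain ⟨m, hm⟩ := exists_nat_ge ((eVariationOn γ (Icc 0 1)).toReal / (c * D0))
  refine key m 0 (left_mem_Icc.2 zero_le_one) ?_
  rwa [div_le_iff₀ (by positivity)] at hm

lemma exponent_choice {p t θ sl β L C : ℝ} (hp : 1 ≤ p) (hθ : 1 ≤ θ) (hL : 0 < L) (hC : 1 ≤ C)
    (hβ : p * β ≤ alphaFun n p sl θ + t) :
    ∃ W e : ℝ, 0 ≤ W ∧ β ≤ e + 1 + t / p ∧ ∀ ρ : ℝ, 0 < ρ → ∀ d : ℝ, L * ρ ^ θ ≤ d →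
      d ≤ 2 * C * ρ → d ^ (sl - n / p - 1) ≤ W * ρ ^ e := by
  have hp0 : 0 < p := by linarith
  set a : ℝ := sl - n / p with ha
  have hpa : p * sl - n = p * a := by rw [ha]; field_simp
  have hmain : ∀ e : ℝ, alphaFun n p sl θ ≤ p * (e + 1) → β ≤ e + 1 + t / p := by
    intro e he
    have h1 : p * β ≤ p * (e + 1 + t / p) := by
      have : p * (e + 1 + t / p) = p * (e + 1) + t := by field_simp
      linarith
    exact le_of_mul_le_mul_left h1 hp0
  by_cases h : a < 1
  · refine ⟨L ^ (a - 1), θ * (a - 1), by positivity, hmain _ ?_, ?_⟩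
    · unfold alphaFun
      rw [hpa]
      split_ifs with h2
      · nlinarith
      · push Not at h2
        nlinarith [mul_nonneg (sub_nonneg.2 hθ) (sub_nonneg.2 h2.le)]
    · intro ρ hρ d hd _
      have hpos : 0 < L * ρ ^ θ := by positivity
      rw [Real.rpow_mul hρ.le, ← Real.mul_rpow hL.le (by positivity)]
      exact Real.rpow_le_rpow_of_nonpos hpos hd (by linarith)
  · push Not at h
    refine ⟨(2 * C) ^ (a - 1), a - 1, by positivity, hmain _ ?_, ?_⟩
    · unfold alphaFun
      rw [hpa, if_neg (by push Not; nlinarith)]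
      linarith
    · intro ρ hρ d hd hd2
      have hpos : 0 < L * ρ ^ θ := by positivity
      rw [← Real.mul_rpow (by positivity) hρ.le]
      exact Real.rpow_le_rpow (by linarith) hd2 (by linarith)

lemma path_est {p t θ β C δΓ M r0 δ : ℝ} {Ω : Set (Euc n)} {s u : Euc n → ℝ} {xb : Euc n}
    {ε : ℝ → ℝ} (hp : 1 ≤ p) (hθ : 1 ≤ θ) (hC : 1 ≤ C) 
    (hδΓ : 0 < δΓ) (hδΓ1 : δΓ < 1) (hM : 0 ≤ M) (hr0 : 0 < r0) (hδ : 0 < δ)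
    (hΩo : IsOpen Ω) (hxb : xb ∈ frontier Ω) (hs0 : ∀ x, 0 ≤ s x)
    (hu : MemN Ω s p u)
    (H2 : ConnectedTo Ω (Ω ∩ ball xb δΓ) xb C θ (δΓ / (3 * C)) ε)
    (hν : ∀ ρ : ℝ, 0 < ρ → ρ ≤ r0 → nuM Ω s p u (ball xb ρ) ≤ M * ρ ^ t)
    (hβ : p * β ≤ alphaLow Ω s p (fun _ => θ) xb δ + t) :
    ∃ ρ1 : ℝ, 0 < ρ1 ∧ ρ1 ≤ δΓ ∧ ∀ lam : ℝ, 0 < lam → lam < 1 → ∃ K : ℝ, 0 ≤ K ∧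
      ∀ ρ : ℝ, 0 < ρ → ρ ≤ ρ1 → ∀ x ∈ Ω ∩ ball xb ρ, ∀ x' ∈ Ω ∩ ball xb ρ,
        (lam * ρ) ^ θ ≤ dB Ω x → (lam * ρ) ^ θ ≤ dB Ω x' →
        |gFun Ω u x - gFun Ω u x'| ≤ K * ρ ^ β := by
  have hp0 : 0 < p := by linarith
  have hfr : (frontier Ω).Nonempty := ⟨xb, hxb⟩
  unfold alphaLow at hβ
  set sl := sLow Ω s xb δ with hsl
  have hsl0 : 0 ≤ sl := by
    apply Real.sInf_nonneg
    rintro _ ⟨y, -, rfl⟩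
    exact hs0 y
  have hsly : ∀ y ∈ Ω ∩ ball xb δ, sl ≤ s y := by
    intro y hy
    have hb : BddBelow (s '' (Ω ∩ ball xb δ)) := by
      refine ⟨0, ?_⟩
      rintro _ ⟨z, -, rfl⟩
      exact hs0 z
    exact csInf_le hb ⟨y, hy, rfl⟩
  obtain ⟨K0, hK0, hstep⟩ := pstep hp hsl0 n
  have hm0 : 0 < min (min r0 δ) δΓ := by positivity
  refine ⟨min (min r0 δ) δΓ / (3 * C), by positivity, ?_, ?_⟩
  · refine (div_le_self hm0.le (by linarith)).trans (min_le_right _ _)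
  intro lam hlam hlam1
  obtain ⟨hε, -, hconn⟩ := H2 lam hlam hlam1
  set L := ε lam with hL
  obtain ⟨W, e, hW, he, hWe⟩ := exponent_choice (n := n) hp hθ hε hC hβ
  refine ⟨16 * C * K0 * W * (M * (3 * C) ^ t) ^ (1 / p), by positivity, ?_⟩
  intro ρ hρ hρ1 x hx x' hx' hdx hdx'
  have h3 : 3 * C * ρ ≤ min (min r0 δ) δΓ := by
    rw [le_div_iff₀ (by positivity)] at hρ1; linarith
  have h3r : 3 * C * ρ ≤ r0 := h3.trans ((min_le_left _ _).trans (min_le_left _ _))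
  have h3δ : 3 * C * ρ ≤ δ := h3.trans ((min_le_left _ _).trans (min_le_right _ _))
  have h3Γ : 3 * C * ρ ≤ δΓ := h3.trans (min_le_right _ _)
  have hCρ : ρ ≤ C * ρ := by nlinarith
  have hρΓ : ρ ≤ δΓ / (3 * C) := by rw [le_div_iff₀ (by positivity)]; linarith
  have hbb : ball xb ρ ⊆ ball xb δΓ := ball_subset_ball (by linarith)
  obtain ⟨γ, hγc, hγ0, hγ1, hγ, hvar⟩ := hconn ρ hρ hρΓ x ⟨⟨hx.1, hbb hx.2⟩, hx.2⟩ x'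
    ⟨⟨hx'.1, hbb hx'.2⟩, hx'.2⟩ hdx hdx'
  have hfin : eVariationOn γ (Icc 0 1) ≠ ⊤ := ne_top_of_le_ne_top ENNReal.ofReal_ne_top hvar
  have hvar' : (eVariationOn γ (Icc 0 1)).toReal ≤ C * ρ :=
    ENNReal.toReal_le_of_le_ofReal (by positivity) hvar
  have hdist : ∀ τ ∈ Icc (0:ℝ) 1, dist (γ τ) xb < 2 * C * ρ := by
    intro τ hτ
    have h1 : dist (γ τ) (γ 0) ≤ (eVariationOn γ (Icc 0 1)).toReal := by
      rw [dist_edist]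
      exact ENNReal.toReal_mono hfin
        (eVariationOn.edist_le γ hτ (left_mem_Icc.2 zero_le_one))
    have h2 := dist_triangle (γ τ) (γ 0) xb
    have h4 : dist (γ 0) xb < ρ := by rw [hγ0]; exact hx.2
    linarith
  have hρ0 : ρ < 1 := by nlinarith
  set K : ℝ := K0 * (W * ρ ^ e) * (M * (3 * C * ρ) ^ t) ^ (1 / p) with hK
  have hKn : 0 ≤ K := by positivity
  have hch := chain (F := fun τ => gFun Ω u (γ τ)) (D := fun τ => dB Ω (γ τ)) (γ := γ)
    (K := K) (R := 2 * C * ρ) (D0 := L * ρ ^ θ) (c := 1 / 14) (by norm_num) (by positivity) hKn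
    hγc hfin (fun τ hτ => ⟨(hγ τ hτ).2, (dB_le_dist hxb _).trans (hdist τ hτ).le⟩) ?_
  · simp only [hγ0, hγ1] at hch
    calc _ ≤ _ := hch
      _ ≤ K * (16 * C * ρ) := by
          apply mul_le_mul_of_nonneg_left _ hKn
          rw [div_div_eq_mul_div, div_one]
          linarith
      _ = 16 * C * K0 * W * (M * (3 * C) ^ t) ^ (1 / p) * ρ ^ (e + 1 + t / p) := by
          rw [hK, Real.mul_rpow (by positivity) hρ.le, ← mul_assoc M,
            Real.mul_rpow (by positivity) (by positivity), ← Real.rpow_mul hρ.le,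
            Real.rpow_add hρ, Real.rpow_add hρ, Real.rpow_one, mul_one_div]
          ring
      _ ≤ _ := by
          apply mul_le_mul_of_nonneg_left _ (by positivity)
          exact Real.rpow_le_rpow_of_exponent_ge hρ hρ0.le he
  · intro τ hτ τ' hτ' hττ
    have hγΩ : γ τ ∈ Ω := (hγ τ hτ).1.1
    have hdpos := dB_pos hΩo hfr hγΩ
    have hdle : dB Ω (γ τ) ≤ 2 * C * ρ := (dB_le_dist hxb _).trans (hdist τ hτ).le
    have hPhi : PhiB Ω (γ τ) ⊆ ball xb (3 * C * ρ) := by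
      apply ball_subset_ball'
      have := hdist τ hτ
      have := dB_le_dist hxb (γ τ)
      linarith
    have hPhi2 : PhiB Ω (γ τ) ⊆ Ω :=
      (ball_subset_ball (by linarith)).trans (ball_dB_subset hΩo hγΩ)
    have h1 := hstep Ω s u (ball xb (3 * C * ρ)) (γ τ) (γ τ') hΩo hfr hu hγΩ
      (by linarith) hPhi (fun y hy => ⟨hsly y ⟨hPhi2 hy,
        ball_subset_ball h3δ (hPhi hy)⟩, by
          have := dB_le_dist hxb y
          have := mem_ball.1 (hPhi hy)
          linarith⟩)
    have h2 := hν (3 * C * ρ) (by positivity) h3r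
    have h4 := hWe ρ hρ (dB Ω (γ τ)) (hγ τ hτ).2 hdle
    refine h1.trans ?_
    have h5 : dB Ω (γ τ) ^ (sl - n / p) = dB Ω (γ τ) ^ (sl - n / p - 1) * dB Ω (γ τ) := by
      rw [Real.rpow_sub_one hdpos.ne']; field_simp
    rw [h5]
    have h6 : nuM Ω s p u (ball xb (3 * C * ρ)) ^ (1 / p) ≤ (M * (3 * C * ρ) ^ t) ^ (1 / p) :=
      Real.rpow_le_rpow (nuM_nonneg _ _ _ _ _) h2 (by positivity)
    calc _ ≤ K0 * (W * ρ ^ e * dB Ω (γ τ)) * (M * (3 * C * ρ) ^ t) ^ (1 / p) := by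
          gcongr
          exact Real.rpow_nonneg (nuM_nonneg _ _ _ _ _) _
      _ = _ := by rw [hK]; ring

lemma density_aux {t M : ℝ} (ht : 0 ≤ t) (hM : 0 < M) (ν : Measure (Euc n)) [IsFiniteMeasure ν]
    (A : Set (Euc n))
    (hA : ∀ x ∈ A, ∀ r : ℝ, 0 < r → ∃ ρ : ℝ, 0 < ρ ∧ ρ ≤ r ∧
      ENNReal.ofReal (M * ρ ^ t) ≤ ν (ball x ρ)) :
    μH[t] A ≤ ENNReal.ofReal (10 ^ t / M) * ν univ := by
  have hk : ∀ k : ℕ, ∃ (U : Set (Euc n)) (ρ : Euc n → ℝ), U.Countable ∧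
      (∀ x ∈ U, 0 < ρ x ∧ ρ x ≤ 1 / ((k : ℝ) + 1) ∧
        ENNReal.ofReal (M * ρ x ^ t) ≤ ν (ball x (ρ x))) ∧
      (U.PairwiseDisjoint fun a => closedBall a (ρ a)) ∧
      A ⊆ ⋃ b : U, closedBall (b : Euc n) (5 * ρ b) := by
    intro k
    have h1 : ∀ x : Euc n, ∃ ρ : ℝ, x ∈ A → 0 < ρ ∧ ρ ≤ 1 / ((k : ℝ) + 1) ∧
        ENNReal.ofReal (M * ρ ^ t) ≤ ν (ball x ρ) := by
      intro x
      by_cases hx : x ∈ A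
      · obtain ⟨ρ, h⟩ := hA x hx (1 / ((k : ℝ) + 1)) (by positivity)
        exact ⟨ρ, fun _ => h⟩
      · exact ⟨0, fun h => absurd h hx⟩
    choose ρ hρ using h1
    obtain ⟨U, hUA, hdis, hcov⟩ := Vitali.exists_disjoint_subfamily_covering_enlargement_closedBall
      A id ρ (1 / ((k : ℝ) + 1)) (fun a ha => (hρ a ha).2.1) 5 (by norm_num)
    refine ⟨U, ρ, ?_, fun x hx => hρ x (hUA hx), hdis, ?_⟩
    · have : U.PairwiseDisjoint fun a => ball a (ρ a) :=
        hdis.mono fun a => ball_subset_closedBall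
      exact this.countable_of_isOpen (fun _ _ => isOpen_ball)
        fun x hx => ⟨x, mem_ball_self (hρ x (hUA hx)).1⟩
    · intro x hx
      obtain ⟨b, hb, hsub⟩ := hcov x hx
      exact mem_iUnion.2 ⟨⟨b, hb⟩, hsub (mem_closedBall_self (hρ x hx).1.le)⟩
  choose U ρ hUc hρ hdis hcov using hk
  have : ∀ k, Countable (U k) := fun k => (hUc k).to_subtype
  have hdiam : ∀ k (b : U k), ediam (closedBall (b : Euc n) (5 * ρ k b)) ≤
      ENNReal.ofReal (10 * ρ k b) := by
    intro k b
    have := (hρ k b b.2).1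
    have h1 : ediam (closedBall (b : Euc n) (5 * ρ k b)) ≤ 2 * ENNReal.ofReal (5 * ρ k b) := by
      rw [← Metric.closedEBall_ofReal (by positivity)]
      exact Metric.ediam_closedEBall_le
    refine h1.trans (le_of_eq ?_)
    rw [show (2 : ℝ≥0∞) = ENNReal.ofReal 2 by simp, ← ENNReal.ofReal_mul (by norm_num)]
    congr 1; ring
  have hH := Measure.hausdorffMeasure_le_liminf_tsum (ι := fun k => U k) t A (l := atTop)
    (fun k : ℕ => ENNReal.ofReal (10 * (1 / ((k : ℝ) + 1)))) ?_
    (fun k b => closedBall (b : Euc n) (5 * ρ k b)) ?_ (Eventually.of_forall hcov)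
  · refine hH.trans ?_
    refine (liminf_le_liminf (v := fun _ => ENNReal.ofReal (10 ^ t / M) * ν univ)
      (Eventually.of_forall fun k => ?_)).trans ?_
    · calc ∑' b : U k, ediam (closedBall (b : Euc n) (5 * ρ k b)) ^ t
          ≤ ∑' b : U k, ENNReal.ofReal (10 ^ t / M) * ν (closedBall (b : Euc n) (ρ k b)) := by
            refine ENNReal.tsum_le_tsum fun b => ?_
            have hb := hρ k b b.2
            have h0 := hb.1
            calc _ ≤ ENNReal.ofReal (10 * ρ k b) ^ t := ENNReal.rpow_le_rpow (hdiam k b) ht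
              _ = ENNReal.ofReal (10 ^ t / M) * ENNReal.ofReal (M * ρ k b ^ t) := by
                  rw [ENNReal.ofReal_rpow_of_nonneg (by positivity) ht,
                    ← ENNReal.ofReal_mul (by positivity), Real.mul_rpow (by norm_num) h0.le]
                  congr 1; field_simp
              _ ≤ _ := by
                  gcongr
                  exact hb.2.2.trans (measure_mono ball_subset_closedBall)
        _ = ENNReal.ofReal (10 ^ t / M) * ∑' b : U k, ν (closedBall (b : Euc n) (ρ k b)) :=
            ENNReal.tsum_mul_left
        _ ≤ _ := by
            gcongr
            refine tsum_measure_le_measure_univ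
              (fun b => measurableSet_closedBall.nullMeasurableSet) ?_
            intro a b hab
            exact (hdis k a.2 b.2 (fun h => hab (Subtype.ext h))).aedisjoint
    · simp
  · have : Tendsto (fun k : ℕ => 10 * (1 / ((k : ℝ) + 1))) atTop (𝓝 (10 * 0)) :=
      tendsto_one_div_add_atTop_nhds_zero_nat.const_mul 10
    have := ENNReal.tendsto_ofReal this
    simpa using this
  · refine Eventually.of_forall fun k b => (hdiam k b).trans ?_
    apply ENNReal.ofReal_le_ofReal
    have := (hρ k b b.2).2.1
    linarith

lemma density {t : ℝ} (ht : 0 ≤ t) (ν : Measure (Euc n)) [IsFiniteMeasure ν] :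
    μH[t] {x : Euc n | ¬ ∃ M r0 : ℝ, 0 ≤ M ∧ 0 < r0 ∧ ∀ ρ : ℝ, 0 < ρ → ρ ≤ r0 →
      ν (ball x ρ) ≤ ENNReal.ofReal (M * ρ ^ t)} = 0 := by
  set A := {x : Euc n | ¬ ∃ M r0 : ℝ, 0 ≤ M ∧ 0 < r0 ∧ ∀ ρ : ℝ, 0 < ρ → ρ ≤ r0 →
      ν (ball x ρ) ≤ ENNReal.ofReal (M * ρ ^ t)} with hA
  have hb : ∀ k : ℕ, μH[t] A ≤ ENNReal.ofReal (10 ^ t / ((k : ℝ) + 1)) * ν univ := by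
    intro k
    refine density_aux ht (by positivity) ν A ?_
    intro x hx r hr
    by_contra hcon
    push Not at hcon
    exact hx ⟨(k : ℝ) + 1, r, by positivity, hr, fun ρ h1 h2 => (hcon ρ h1 h2).le⟩
  have hlim : Tendsto (fun k : ℕ => ENNReal.ofReal (10 ^ t / ((k : ℝ) + 1)) * ν univ) atTop
      (𝓝 0) := by
    have h1 : Tendsto (fun k : ℕ => (10 : ℝ) ^ t / ((k : ℝ) + 1)) atTop (𝓝 0) := by
      have := tendsto_one_div_add_atTop_nhds_zero_nat (𝕜 := ℝ) |>.const_mul ((10 : ℝ) ^ t)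
      simpa [div_eq_mul_inv] using this
    have h2 := ENNReal.tendsto_ofReal h1
    have h3 := ENNReal.Tendsto.mul_const (b := ν univ) h2 (Or.inr (measure_ne_top ν _))
    simpa using h3
  exact le_antisymm (ge_of_tendsto' hlim hb) bot_le

lemma nuM_density {t p : ℝ} (ht : 0 ≤ t) {Ω : Set (Euc n)} {s u : Euc n → ℝ} 
    (hu : MemN Ω s p u) :
    μH[t] {x : Euc n | ¬ ∃ M r0 : ℝ, 0 ≤ M ∧ 0 < r0 ∧ ∀ ρ : ℝ, 0 < ρ → ρ ≤ r0 →
      nuM Ω s p u (ball x ρ) ≤ M * ρ ^ t} = 0 := by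
  have hI : Integrable (nuInt Ω s p u) (volume.restrict Ω) := hu.2
  set ν : Measure (Euc n) := (volume.restrict Ω).withDensity
    (fun x => ENNReal.ofReal (nuInt Ω s p u x)) with hν
  have : IsFiniteMeasure ν := isFiniteMeasure_withDensity_ofReal hI.2
  refine measure_mono_null ?_ (density ht ν)
  intro x hx hcon
  apply hx
  obtain ⟨M, r0, hM, hr0, h⟩ := hcon
  refine ⟨M, r0, hM, hr0, fun ρ h1 h2 => ?_⟩
  have h3 := h ρ h1 h2
  rw [hν, withDensity_apply _ measurableSet_ball, Measure.restrict_restrict measurableSet_ball,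
    ← ofReal_integral_eq_lintegral_ofReal (hu.2.mono_set inter_subset_right)
      (Eventually.of_forall fun _ => nuInt_nonneg _ _ _ _ _), inter_comm] at h3
  rwa [ENNReal.ofReal_le_ofReal_iff (by positivity)] at h3

lemma alphaLow_tendsto {p : ℝ} {Ω : Set (Euc n)} {s : Euc n → ℝ} {θΓ : Euc n → ℝ}
    {xb : Euc n} (hxb : xb ∈ frontier Ω)
    (hs0 : ∀ x, 0 ≤ s x) (hsb : ∃ b : ℝ, ∀ x, s x ≤ b) :
    Tendsto (fun δ => alphaLow Ω s p θΓ xb δ) (𝓝[>] (0:ℝ)) (𝓝 (alphaLow0 Ω s p θΓ xb)) := by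
  obtain ⟨b, hb⟩ := hsb
  have hne : ∀ δ : ℝ, 0 < δ → (s '' (Ω ∩ ball xb δ)).Nonempty := by
    intro δ hδ
    have : xb ∈ closure Ω := frontier_subset_closure hxb
    obtain ⟨y, hy, hyd⟩ := Metric.mem_closure_iff.1 this δ hδ
    exact ⟨s y, y, ⟨hy, by rwa [mem_ball, dist_comm]⟩, rfl⟩
  have hbd : ∀ δ : ℝ, BddBelow (s '' (Ω ∩ ball xb δ)) := by
    intro δ
    refine ⟨0, ?_⟩
    rintro _ ⟨z, -, rfl⟩
    exact hs0 z
  have hanti : AntitoneOn (sLow Ω s xb) (Ioi 0) := by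
    intro x hx y hy hxy
    exact csInf_le_csInf (hbd y) (hne x hx) (image_mono (inter_subset_inter_right _
      (ball_subset_ball hxy)))
  have hsup : BddAbove (sLow Ω s xb '' Ioi 0) := by
    refine ⟨b, ?_⟩
    rintro _ ⟨δ, hδ, rfl⟩
    obtain ⟨v, y, hy, rfl⟩ := hne δ hδ
    exact (csInf_le (hbd δ) ⟨y, hy, rfl⟩).trans (hb y)
  have ht := hanti.tendsto_nhdsGT hsup
  have hcont : Continuous fun sv => alphaFun n p sv (θΓ xb) := by
    unfold alphaFun
    refine Continuous.if_le (by fun_prop) (by fun_prop) (by fun_prop) (by fun_prop) ?_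
    intro x hx
    rw [hx]; ring
  have h1 : Tendsto (fun δ => alphaLow Ω s p θΓ xb δ) (𝓝[>] (0:ℝ)) (𝓝 _) :=
    (hcont.tendsto _).comp ht
  exact tendsto_nhds_limUnder ⟨_, h1⟩

/-- The rate estimate at `xb` with exponent `β` and limit value `T`. -/
def RateAt (Ω : Set (Euc n)) (u : Euc n → ℝ) (θ : ℝ) (xb : Euc n) (T β : ℝ) : Prop :=
  ∃ δβ : ℝ, 0 < δβ ∧ ∀ lam : ℝ, 0 < lam → lam < 1 →
    ∃ C : ℝ, ∀ x ∈ Qreg Ω lam θ xb ∩ ball xb δβ, |T - gFun Ω u x| ≤ C * dist xb x ^ β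

lemma RateAt.tendsto {Ω : Set (Euc n)} {u : Euc n → ℝ} {θ : ℝ} {xb : Euc n} {T β : ℝ}
    (h : RateAt Ω u θ xb T β) (hβ : 0 < β) {lam : ℝ} (hl : 0 < lam) (hl1 : lam < 1) :
    Tendsto (gFun Ω u) (𝓝[Qreg Ω lam θ xb] xb) (𝓝 T) := by
  obtain ⟨δ, hδ, h⟩ := h
  obtain ⟨C, hC⟩ := h lam hl hl1
  rw [tendsto_iff_dist_tendsto_zero]
  have h0 : Tendsto (fun x => C * dist xb x ^ β) (𝓝[Qreg Ω lam θ xb] xb) (𝓝 0) := by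
    have hc : Continuous fun x : Euc n => C * dist xb x ^ β :=
      continuous_const.mul ((continuous_const.dist continuous_id).rpow_const
        fun _ => Or.inr hβ.le)
    have := hc.tendsto xb
    simp only [dist_self, Real.zero_rpow hβ.ne', mul_zero] at this
    exact this.mono_left nhdsWithin_le_nhds
  refine squeeze_zero' (Eventually.of_forall fun _ => dist_nonneg) ?_ h0
  filter_upwards [self_mem_nhdsWithin, mem_nhdsWithin_of_mem_nhds (ball_mem_nhds xb hδ)]
    with x hx1 hx2
  rw [dist_comm, Real.dist_eq]
  exact hC x ⟨hx1, hx2⟩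

lemma isOpen_Qreg {Ω : Set (Euc n)} (hΩo : IsOpen Ω) {lam θ : ℝ} (hθ : 1 ≤ θ) (xb : Euc n) :
    IsOpen (Qreg Ω lam θ xb) := by
  have h : IsOpen {x : Euc n | (lam * dist xb x) ^ θ < dB Ω x} := by
    refine isOpen_lt ?_ ?_
    · exact (continuous_const.mul (continuous_const.dist continuous_id)).rpow_const
        fun _ => Or.inr (by linarith)
    · exact continuous_infDist_pt _
  exact hΩo.inter h

lemma corkscrew_nonempty {Ω Q : Set (Euc n)} {xb : Euc n} {η θ δ₀ : ℝ} (hδ₀ : 0 < δ₀)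
    (h : IsCorkscrew Ω Q xb η θ δ₀) {r : ℝ} (hr : 0 < r) : (Q ∩ ball xb r).Nonempty := by
  obtain ⟨x, hx, -, h2, -⟩ := h (min r δ₀) (by positivity) (min_le_right _ _)
  exact ⟨x, hx, by rw [mem_ball, dist_comm]; exact h2.trans_le (min_le_left _ _)⟩

lemma corkscrew_neBot {Ω Q : Set (Euc n)} {xb : Euc n} {η θ δ₀ : ℝ} (hδ₀ : 0 < δ₀)
    (h : IsCorkscrew Ω Q xb η θ δ₀) : (𝓝[Q] xb).NeBot := by
  rw [← mem_closure_iff_nhdsWithin_neBot, Metric.mem_closure_iff]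
  intro r hr
  obtain ⟨x, hx, hx2⟩ := corkscrew_nonempty hδ₀ h hr
  exact ⟨x, hx, by rwa [mem_ball, dist_comm] at hx2⟩

lemma rate_exists {Ω : Set (Euc n)} (hΩo : IsOpen Ω) {u : Euc n → ℝ} {θ β δΓ lam₀ η₀ ρ1 : ℝ}
    {xb : Euc n} (hxb : xb ∈ frontier Ω) (hθ : 1 ≤ θ) (hβ : 0 < β)
    (hη₀ : 0 < η₀) (hη₀1 : η₀ < 1)
    (H1 : IsCorkscrew Ω (Qreg Ω lam₀ θ xb) xb η₀ θ δΓ) (hρ1 : 0 < ρ1) (hρ1Γ : ρ1 ≤ δΓ)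
    (hest : ∀ lam : ℝ, 0 < lam → lam < 1 → ∃ K : ℝ, 0 ≤ K ∧
      ∀ ρ : ℝ, 0 < ρ → ρ ≤ ρ1 → ∀ x ∈ Ω ∩ ball xb ρ, ∀ x' ∈ Ω ∩ ball xb ρ,
        (lam * ρ) ^ θ ≤ dB Ω x → (lam * ρ) ^ θ ≤ dB Ω x' →
        |gFun Ω u x - gFun Ω u x'| ≤ K * ρ ^ β) :
    ∃ T : ℝ, RateAt Ω u θ xb T β := by
  have hθ0 : 0 ≤ θ := by linarith
  set c : ℕ → ℝ := fun k => ρ1 * (1 / 2) ^ k with hc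
  have hc0 : ∀ k, 0 < c k := fun k => by positivity
  have hcle : ∀ k, c k ≤ ρ1 := fun k =>
    mul_le_of_le_one_right hρ1.le (pow_le_one₀ (by norm_num) (by norm_num))
  have hcs : ∀ k, c (k + 1) = c k / 2 := fun k => by simp only [hc, pow_succ]; ring
  have hw : ∀ k, ∃ w ∈ Ω, dist xb w < c k ∧ (η₀ * c k) ^ θ < dB Ω w := by
    intro k
    obtain ⟨x, hx, -, h2, h3⟩ := H1 (c k) (hc0 k) ((hcle k).trans hρ1Γ)
    exact ⟨x, hx.1, h2, h3⟩
  choose w hwΩ hwd hwB using hw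
  obtain ⟨K, hK, hK'⟩ := hest (η₀ / 2) (by linarith) (by linarith)
  set r : ℝ := (1 / 2) ^ β with hr
  have hr0 : 0 < r := by positivity
  have hr1 : r < 1 := Real.rpow_lt_one (by norm_num) (by norm_num) hβ
  have hcβ : ∀ k, c k ^ β = ρ1 ^ β * r ^ k := by
    intro k
    simp only [hc, hr]
    rw [Real.mul_rpow hρ1.le (by positivity), ← Real.rpow_natCast, ← Real.rpow_mul (by norm_num),
      ← Real.rpow_natCast, ← Real.rpow_mul (by norm_num), mul_comm (k : ℝ)]
  have hgeo : ∀ k, dist (gFun Ω u (w k)) (gFun Ω u (w (k + 1))) ≤ (K * ρ1 ^ β) * r ^ k := by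
    intro k
    rw [Real.dist_eq, mul_assoc, ← hcβ]
    have h1 := hwd (k + 1)
    have hk := hc0 k
    have h2 := hwB (k + 1)
    rw [hcs] at h1 h2
    refine hK' (c k) (hc0 k) (hcle k) (w k) ⟨hwΩ k, by rw [mem_ball, dist_comm]; exact hwd k⟩
      (w (k + 1)) ⟨hwΩ _, by rw [mem_ball, dist_comm]; linarith⟩ ?_ ?_
    · refine le_trans (Real.rpow_le_rpow (by positivity) ?_ hθ0) (hwB k).le
      nlinarith
    · refine le_trans (le_of_eq ?_) h2.le
      congr 1; ring
  obtain ⟨T, hT⟩ := cauchySeq_tendsto_of_complete (cauchySeq_of_le_geometric r _ hr1 hgeo)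
  have hTk : ∀ k, |gFun Ω u (w k) - T| ≤ K / (1 - r) * c k ^ β := by
    intro k
    have := dist_le_of_le_geometric_of_tendsto r _ hr1 hgeo hT k
    rw [Real.dist_eq] at this
    refine this.trans (le_of_eq ?_)
    rw [hcβ]; ring
  refine ⟨T, ρ1 / 2, by positivity, fun lam hlam hlam1 => ?_⟩
  obtain ⟨K2, hK2, hK2'⟩ := hest (min (lam / 4) η₀) (by positivity)
    ((min_le_right _ _).trans_lt hη₀1)
  refine ⟨(K / (1 - r) + K2) * 4 ^ β, ?_⟩
  rintro x ⟨⟨hxΩ, hxQ⟩, hxρ⟩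
  rw [mem_ball, dist_comm] at hxρ
  have hne : xb ≠ x := by
    rintro rfl
    rw [hΩo.frontier_eq] at hxb
    exact hxb.2 hxΩ
  have hd0 : 0 < dist xb x := dist_pos.2 hne
  obtain ⟨k, hk1, hk2⟩ := exists_nat_pow_near_of_lt_one (x := 2 * dist xb x / ρ1) (y := (1 / 2 : ℝ))
    (by positivity) (by rw [div_le_one hρ1]; linarith) (by norm_num) (by norm_num)
  rw [lt_div_iff₀ hρ1] at hk1
  rw [div_le_iff₀ hρ1] at hk2
  have hk1' : c k ≤ 4 * dist xb x := by
    simp only [hc]; rw [pow_succ] at hk1; linarith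
  have hk2' : 2 * dist xb x ≤ c k := by simp only [hc]; linarith
  have hck := hc0 k
  have h1 := hK2' (c k) hck (hcle k) x ⟨hxΩ, by rw [mem_ball, dist_comm]; linarith⟩ (w k)
    ⟨hwΩ k, by rw [mem_ball, dist_comm]; exact hwd k⟩ ?_ ?_
  · have h2 := hTk k
    have h1r : 0 < 1 - r := by linarith
    have h3 : c k ^ β ≤ 4 ^ β * dist xb x ^ β := by
      rw [← Real.mul_rpow (by norm_num) hd0.le]
      exact Real.rpow_le_rpow hck.le hk1' hβ.le
    calc |T - gFun Ω u x| ≤ |T - gFun Ω u (w k)| + |gFun Ω u (w k) - gFun Ω u x| :=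
          abs_sub_le _ _ _
      _ ≤ (K / (1 - r) + K2) * c k ^ β := by
          rw [abs_sub_comm T, abs_sub_comm (gFun Ω u (w k)) (gFun Ω u x)]; linarith
      _ ≤ (K / (1 - r) + K2) * (4 ^ β * dist xb x ^ β) := by gcongr
      _ = _ := by ring
  · refine le_trans (Real.rpow_le_rpow (by positivity) ?_ hθ0) hxQ.le
    have := min_le_left (lam / 4) η₀
    calc _ ≤ lam / 4 * (4 * dist xb x) := by gcongr
      _ = _ := by ring
  · refine le_trans (Real.rpow_le_rpow (by positivity) ?_ hθ0) (hwB k).le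
    gcongr
    exact min_le_right _ _

lemma meas_select {Ω : Set (Euc n)} (hΩo : IsOpen Ω) {θΓ : Euc n → ℝ} (hθm : Measurable θΓ)
    (hθ1 : ∀ xb, 1 ≤ θΓ xb) {Γ' : Set (Euc n)} (hΓ' : MeasurableSet Γ') (lam₀ : ℝ)
    (hne : ∀ xb ∈ Γ', ∀ r : ℝ, 0 < r → (Qreg Ω lam₀ (θΓ xb) xb ∩ ball xb r).Nonempty)
    (g : Euc n → ℝ) (f : Euc n → ℝ)
    (hf : ∀ xb ∈ Γ', Tendsto g (𝓝[Qreg Ω lam₀ (θΓ xb) xb] xb) (𝓝 (f xb))) :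
    Measurable (Γ'.indicator f) := by
  classical
  let D : ℕ → Euc n := TopologicalSpace.denseSeq (Euc n)
  have hD : DenseRange D := TopologicalSpace.denseRange_denseSeq _
  have hex : ∀ (k : ℕ) (xb : Euc n), ∃ N : ℕ, xb ∈ Γ' →
      (D N ∈ Ω ∧ (lam₀ * dist xb (D N)) ^ θΓ xb < dB Ω (D N)) ∧
        dist (D N) xb < 1 / ((k : ℝ) + 1) := by
    intro k xb
    by_cases hx : xb ∈ Γ'
    · have ho : IsOpen (Qreg Ω lam₀ (θΓ xb) xb ∩ ball xb (1 / ((k : ℝ) + 1))) :=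
        (isOpen_Qreg hΩo (hθ1 xb) xb).inter isOpen_ball
      obtain ⟨N, hN⟩ := hD.exists_mem_open ho (hne xb hx _ (by positivity))
      exact ⟨N, fun _ => ⟨hN.1, hN.2⟩⟩
    · exact ⟨0, fun h => absurd h hx⟩
  have hmeas : ∀ k : ℕ, Measurable fun xb => Nat.find (hex k xb) := by
    intro k
    refine measurable_find (hex k) fun N => ?_
    have h1 : MeasurableSet {xb : Euc n | (lam₀ * dist xb (D N)) ^ θΓ xb < dB Ω (D N)} :=
      measurableSet_lt (((measurable_id.dist measurable_const).const_mul lam₀).pow hθm)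
        measurable_const
    have h2 : MeasurableSet {xb : Euc n | dist (D N) xb < 1 / ((k : ℝ) + 1)} :=
      measurableSet_lt (measurable_const.dist measurable_id) measurable_const
    have h3 : MeasurableSet {xb : Euc n | D N ∈ Ω} := MeasurableSet.const _
    convert hΓ'.compl.union ((h3.inter h1).inter h2) using 1
    ext xb
    simp only [mem_ofPred_eq, mem_union, mem_compl_iff, mem_inter_iff]
    tauto
  have hgm : ∀ k : ℕ, Measurable
      (Γ'.indicator fun xb => g (D (Nat.find (hex k xb)))) := fun k =>
    ((measurable_from_top (f := fun N : ℕ => g (D N))).comp (hmeas k)).indicator hΓ'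
  refine measurable_of_tendsto_metrizable hgm ?_
  rw [tendsto_pi_nhds]
  intro xb
  by_cases hx : xb ∈ Γ'
  · simp only [indicator_of_mem hx]
    refine (hf xb hx).comp ?_
    have hsp := fun k => Nat.find_spec (hex k xb) hx
    rw [tendsto_nhdsWithin_iff]
    refine ⟨?_, Eventually.of_forall fun k => (hsp k).1⟩
    rw [tendsto_iff_dist_tendsto_zero]
    exact squeeze_zero (fun _ => dist_nonneg) (fun k => (hsp k).2.le)
      tendsto_one_div_add_atTop_nhds_zero_nat
  · simp only [indicator_of_notMem hx]
    exact tendsto_const_nhds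

/-- The trace properties of `u` with trace function `f` and exceptional set. -/
def TraceProp (Ω : Set (Euc n)) (s : Euc n → ℝ) (p t : ℝ) (θΓ : Euc n → ℝ) (Γ : Set (Euc n))
    (u f : Euc n → ℝ) : Prop :=
  ∃ Γ' : Set (Euc n), Γ' ⊆ Γ ∧ MeasurableSet Γ' ∧ μH[t] (Γ \ Γ') = 0 ∧
    (∀ xb ∈ Γ', ∀ lam : ℝ, 0 < lam → lam < 1 →
      Tendsto (gFun Ω u) (𝓝[Qreg Ω lam (θΓ xb) xb] xb) (𝓝 (f xb))) ∧
    (∀ xb ∈ Γ', ∀ β : ℝ, 0 < β → β < (alphaLow0 Ω s p θΓ xb + t) / p →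
      RateAt Ω u (θΓ xb) xb (f xb) β)

lemma single_trace (p t CΓ δΓ : ℝ)
    (hp : 1 ≤ p) (ht : 0 ≤ t) (hCΓ : 1 ≤ CΓ) (hδΓ0 : 0 < δΓ) (hδΓ1 : δΓ < 1)
    (Ω : Set (Euc n)) (hΩo : IsOpen Ω)
    (Γ : Set (Euc n)) (hΓmeas : MeasurableSet Γ) (hΓfr : Γ ⊆ frontier Ω)
    (θΓ : Euc n → ℝ) (hθm : Measurable θΓ) (hθ1 : ∀ xb, 1 ≤ θΓ xb)
    (s : Euc n → ℝ) (hs0 : ∀ x, 0 ≤ s x) (hsb : ∃ b : ℝ, ∀ x, s x ≤ b)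
    (lam₀ η₀ : ℝ) (hlam₀ : 0 < lam₀) (hlam₀1 : lam₀ < 1) (hη₀ : 0 < η₀) (hη₀1 : η₀ < 1)
    (H1 : ∀ xb ∈ Γ, IsCorkscrew Ω (Qreg Ω lam₀ (θΓ xb) xb) xb η₀ (θΓ xb) δΓ)
    (ε : ℝ → ℝ)
    (H2 : ∀ xb ∈ Γ, ConnectedTo Ω (Ω ∩ ball xb δΓ) xb CΓ (θΓ xb) (δΓ / (3 * CΓ)) ε)
    (H3' : ∀ᵐ xb ∂(μH[t].restrict Γ), -t < alphaLow0 Ω s p θΓ xb)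
    (u : Euc n → ℝ) (hu : MemN Ω s p u) :
    ∃ f : Euc n → ℝ, Measurable f ∧ TraceProp Ω s p t θΓ Γ u f := by
  have hp0 : 0 < p := by linarith
  set Good : Set (Euc n) := {xb | -t < alphaLow0 Ω s p θΓ xb ∧
    ∃ M r0 : ℝ, 0 ≤ M ∧ 0 < r0 ∧ ∀ ρ : ℝ, 0 < ρ → ρ ≤ r0 →
      nuM Ω s p u (ball xb ρ) ≤ M * ρ ^ t} with hGood
  have hbad : μH[t] (Γ \ Good) = 0 := by
    rw [ae_restrict_iff' hΓmeas, ae_iff] at H3'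
    refine measure_mono_null ?_ (measure_union_null H3' (nuM_density ht hu))
    rintro x ⟨hx, hxn⟩
    by_cases h : -t < alphaLow0 Ω s p θΓ x
    · exact Or.inr fun hc => hxn ⟨h, hc⟩
    · exact Or.inl fun hc => h (hc hx)
  set Γ' : Set (Euc n) := Γ \ toMeasurable μH[t] (Γ \ Good) with hΓ'
  have hΓ'm : MeasurableSet Γ' := hΓmeas.diff (measurableSet_toMeasurable _ _)
  have hΓ'G : ∀ xb ∈ Γ', xb ∈ Good := by
    intro xb hx
    by_contra h
    exact hx.2 (subset_toMeasurable _ _ ⟨hx.1, h⟩)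
  have hΓ'n : μH[t] (Γ \ Γ') = 0 := by
    refine measure_mono_null ?_ ((measure_toMeasurable (μ := μH[t]) (Γ \ Good)).trans hbad)
    rintro x ⟨hx, hxn⟩
    by_contra h
    exact hxn ⟨hx, h⟩
  have hrate : ∀ xb ∈ Γ', ∀ β : ℝ, 0 < β → β < (alphaLow0 Ω s p θΓ xb + t) / p →
      ∃ T, RateAt Ω u (θΓ xb) xb T β := by
    intro xb hx β hβ hβ2
    obtain ⟨-, M, r0, hM, hr0, hν⟩ := hΓ'G xb hx
    rw [lt_div_iff₀ hp0] at hβ2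
    have hlim := alphaLow_tendsto (p := p) (θΓ := θΓ) (hΓfr hx.1) hs0 hsb
    have hev := hlim.eventually (lt_mem_nhds (show p * β - t < alphaLow0 Ω s p θΓ xb by linarith))
    obtain ⟨δ, hδ1, hδ0⟩ := (hev.and self_mem_nhdsWithin).exists
    have hδ0 : 0 < δ := hδ0
    obtain ⟨ρ1, h1, h2, h3⟩ := path_est (β := β) (t := t) hp (hθ1 xb) hCΓ hδΓ0 hδΓ1 hM hr0 hδ0 hΩo
      (hΓfr hx.1) hs0 hu (H2 xb hx.1) hν (by
        have : alphaLow Ω s p (fun _ => θΓ xb) xb δ = alphaLow Ω s p θΓ xb δ := rfl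
        rw [this]; linarith)
    exact rate_exists hΩo (hΓfr hx.1) (hθ1 xb) hβ hη₀ hη₀1 (H1 xb hx.1) h1 h2 h3
  have hf0 : ∀ xb : Euc n, ∃ T : ℝ, xb ∈ Γ' → ∀ β : ℝ, 0 < β →
      β < (alphaLow0 Ω s p θΓ xb + t) / p → RateAt Ω u (θΓ xb) xb T β := by
    intro xb
    by_cases hx : xb ∈ Γ'
    · have hpos : 0 < (alphaLow0 Ω s p θΓ xb + t) / p :=
        div_pos (by linarith [(hΓ'G xb hx).1]) hp0
      obtain ⟨T, hT⟩ := hrate xb hx _ (half_pos hpos) (half_lt_self hpos)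
      refine ⟨T, fun _ β hβ hβ2 => ?_⟩
      obtain ⟨T', hT'⟩ := hrate xb hx β hβ hβ2
      have := corkscrew_neBot hδΓ0 (H1 xb hx.1)
      have heq : T = T' := tendsto_nhds_unique (hT.tendsto (half_pos hpos) hlam₀ hlam₀1)
        (hT'.tendsto hβ hlam₀ hlam₀1)
      rwa [heq]
    · exact ⟨0, fun h => absurd h hx⟩
  choose f hf using hf0
  have htend : ∀ xb ∈ Γ', ∀ lam : ℝ, 0 < lam → lam < 1 →
      Tendsto (gFun Ω u) (𝓝[Qreg Ω lam (θΓ xb) xb] xb) (𝓝 (f xb)) := by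
    intro xb hx lam hl hl1
    have hpos : 0 < (alphaLow0 Ω s p θΓ xb + t) / p :=
      div_pos (by linarith [(hΓ'G xb hx).1]) hp0
    exact (hf xb hx _ (half_pos hpos) (half_lt_self hpos)).tendsto (half_pos hpos) hl hl1
  refine ⟨Γ'.indicator f, ?_, Γ', sdiff_subset, hΓ'm, hΓ'n, ?_, ?_⟩
  · exact meas_select hΩo hθm hθ1 hΓ'm lam₀
      (fun xb hx r hr => corkscrew_nonempty hδΓ0 (H1 xb hx.1) hr) (gFun Ω u) f
      (fun xb hx => htend xb hx lam₀ hlam₀ hlam₀1)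
  · intro xb hx
    rw [indicator_of_mem hx]
    exact htend xb hx
  · intro xb hx
    rw [indicator_of_mem hx]
    exact hf xb hx

lemma gFun_add {Ω : Set (Euc n)} (hΩo : IsOpen Ω) {u v : Euc n → ℝ} (hu : IntegrableOn u Ω)
    (hv : IntegrableOn v Ω) {x : Euc n} (hx : x ∈ Ω) :
    gFun Ω (u + v) x = gFun Ω u x + gFun Ω v x := by
  have hPhi : PhiB Ω x ⊆ Ω :=
    (ball_subset_ball (by have := dB_nonneg Ω x; linarith)).trans (ball_dB_subset hΩo hx)
  unfold gFun
  simp only [setAverage_eq, smul_eq_mul, Pi.add_apply]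
  rw [integral_add (hu.mono_set hPhi) (hv.mono_set hPhi)]
  ring

lemma gFun_smul (Ω : Set (Euc n)) (a : ℝ) (u : Euc n → ℝ) (x : Euc n) :
    gFun Ω (a • u) x = a * gFun Ω u x := by
  unfold gFun
  simp only [setAverage_eq, smul_eq_mul, Pi.smul_apply]
  rw [integral_const_mul]
  ring

lemma TraceProp.add {Ω : Set (Euc n)} (hΩo : IsOpen Ω) {s : Euc n → ℝ} {p t : ℝ}
    {θΓ : Euc n → ℝ} {Γ : Set (Euc n)} {u v f g : Euc n → ℝ}
    (hui : IntegrableOn u Ω) (hvi : IntegrableOn v Ω)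
    (hu : TraceProp Ω s p t θΓ Γ u f) (hv : TraceProp Ω s p t θΓ Γ v g) :
    TraceProp Ω s p t θΓ Γ (u + v) (f + g) := by
  obtain ⟨A, hA, hAm, hA0, hA1, hA2⟩ := hu
  obtain ⟨B, -, hBm, hB0, hB1, hB2⟩ := hv
  refine ⟨A ∩ B, inter_subset_left.trans hA, hAm.inter hBm, ?_, ?_, ?_⟩
  · rw [sdiff_inter]; exact measure_union_null hA0 hB0
  · intro xb hx lam hl hl1
    refine ((hA1 xb hx.1 lam hl hl1).add (hB1 xb hx.2 lam hl hl1)).congr' ?_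
    filter_upwards [self_mem_nhdsWithin] with x hx
    exact (gFun_add hΩo hui hvi hx.1).symm
  · intro xb hx β hβ hβ2
    obtain ⟨δ1, hδ1, h1⟩ := hA2 xb hx.1 β hβ hβ2
    obtain ⟨δ2, hδ2, h2⟩ := hB2 xb hx.2 β hβ hβ2
    refine ⟨min δ1 δ2, by positivity, fun lam hl hl1 => ?_⟩
    obtain ⟨C1, hC1⟩ := h1 lam hl hl1
    obtain ⟨C2, hC2⟩ := h2 lam hl hl1
    refine ⟨C1 + C2, fun x hx => ?_⟩
    have e1 := hC1 x ⟨hx.1, ball_subset_ball (min_le_left _ _) hx.2⟩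
    have e2 := hC2 x ⟨hx.1, ball_subset_ball (min_le_right _ _) hx.2⟩
    rw [gFun_add hΩo hui hvi hx.1.1, Pi.add_apply]
    calc _ = |(f xb - gFun Ω u x) + (g xb - gFun Ω v x)| := by congr 1; ring
      _ ≤ _ := abs_add_le _ _
      _ ≤ _ := by linarith

lemma TraceProp.smul {Ω : Set (Euc n)} {s : Euc n → ℝ} {p t : ℝ}
    {θΓ : Euc n → ℝ} {Γ : Set (Euc n)} {u f : Euc n → ℝ} (a : ℝ)
    (hu : TraceProp Ω s p t θΓ Γ u f) :
    TraceProp Ω s p t θΓ Γ (a • u) (a • f) := by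
  obtain ⟨A, hA, hAm, hA0, hA1, hA2⟩ := hu
  refine ⟨A, hA, hAm, hA0, ?_, ?_⟩
  · intro xb hx lam hl hl1
    refine ((hA1 xb hx lam hl hl1).const_mul a).congr fun x => ?_
    exact (gFun_smul Ω a u x).symm
  · intro xb hx β hβ hβ2
    obtain ⟨δ1, hδ1, h1⟩ := hA2 xb hx β hβ hβ2
    refine ⟨δ1, hδ1, fun lam hl hl1 => ?_⟩
    obtain ⟨C1, hC1⟩ := h1 lam hl hl1
    refine ⟨|a| * C1, fun x hx => ?_⟩
    have e1 := hC1 x hx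
    rw [gFun_smul, Pi.smul_apply, smul_eq_mul, ← mul_sub, abs_mul, mul_assoc]
    gcongr

lemma TraceProp.zero {Ω : Set (Euc n)} {s : Euc n → ℝ} {p t : ℝ}
    {θΓ : Euc n → ℝ} {Γ : Set (Euc n)} (hΓ : MeasurableSet Γ) :
    TraceProp Ω s p t θΓ Γ 0 0 := by
  have h0 : gFun Ω 0 = fun _ => 0 := by
    funext x; unfold gFun; simp
  refine ⟨Γ, subset_rfl, hΓ, by simp, ?_, ?_⟩
  · intro xb hx lam hl hl1
    rw [h0]
    exact tendsto_const_nhds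
  · intro xb hx β hβ hβ2
    refine ⟨1, one_pos, fun lam hl hl1 => ⟨0, fun x hx => ?_⟩⟩
    rw [h0]; simp

/-- existence of the trace operator. Under (H1), (H2) and (H3′), there is a
linear operator `T` from `𝒩^{s,p}(Ω)` to measurable functions on `Γ` such that for each
`u ∈ 𝒩^{s,p}(Ω)` there is a full-`H^t`-measure Borel set `Γ′ ⊆ Γ` on which `g(·;u) → Tu(xb)`
along every approach region `Q_λ(xb)`, together with a Hölder-type rate for every
`0 < β < (α̲_0(xb) + t)/p`. -/
theorem statement10 (n : ℕ) (hn : 1 ≤ n) (p t CΓ δΓ : ℝ)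
    (hp : 1 ≤ p) (ht : 0 ≤ t) (htn : t < n) (hCΓ : 1 ≤ CΓ) (hδΓ0 : 0 < δΓ) (hδΓ1 : δΓ < 1)
    (Ω : Set (Euc n)) (hΩo : IsOpen Ω) (hΩne : Ω.Nonempty) (hfr : (frontier Ω).Nonempty)
    (Γ : Set (Euc n)) (hΓmeas : MeasurableSet Γ) (hΓfr : Γ ⊆ frontier Ω)
    (θΓ : Euc n → ℝ) (hθm : Measurable θΓ) (hθ1 : ∀ xb, 1 ≤ θΓ xb)
    (hθb : ∃ b : ℝ, ∀ xb, θΓ xb ≤ b)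
    (s : Euc n → ℝ) (hsm : Measurable s) (hs0 : ∀ x, 0 ≤ s x) (hsb : ∃ b : ℝ, ∀ x, s x ≤ b)
    (lam₀ η₀ : ℝ) (hlam₀ : 0 < lam₀) (hlam₀1 : lam₀ < 1) (hη₀ : 0 < η₀) (hη₀1 : η₀ < 1)
    (H1 : ∀ xb ∈ Γ, IsCorkscrew Ω (Qreg Ω lam₀ (θΓ xb) xb) xb η₀ (θΓ xb) δΓ)
    (ε : ℝ → ℝ) (hεmono : ∀ a b : ℝ, 0 < a → a ≤ b → b < 1 → ε a ≤ ε b)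
    (H2 : ∀ xb ∈ Γ, ConnectedTo Ω (Ω ∩ ball xb δΓ) xb CΓ (θΓ xb) (δΓ / (3 * CΓ)) ε)
    (H3' : ∀ᵐ xb ∂(μH[t].restrict Γ), -t < alphaLow0 Ω s p θΓ xb) :
    ∃ T : (Euc n → ℝ) → Euc n → ℝ,
      (∀ u v : Euc n → ℝ, MemN Ω s p u → MemN Ω s p v →
        ∀ xb ∈ Γ, T (u + v) xb = T u xb + T v xb) ∧
      (∀ (u : Euc n → ℝ) (a : ℝ), MemN Ω s p u →
        ∀ xb ∈ Γ, T (fun x => a * u x) xb = a * T u xb) ∧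
      (∀ u : Euc n → ℝ, MemN Ω s p u → Measurable (T u)) ∧
      ∀ u : Euc n → ℝ, MemN Ω s p u →
        ∃ Γ' : Set (Euc n), Γ' ⊆ Γ ∧ MeasurableSet Γ' ∧ μH[t] (Γ \ Γ') = 0 ∧
          (∀ xb ∈ Γ', ∀ lam : ℝ, 0 < lam → lam < 1 →
            Tendsto (gFun Ω u) (𝓝[Qreg Ω lam (θΓ xb) xb] xb) (𝓝 (T u xb))) ∧
          (∀ xb ∈ Γ', ∀ β : ℝ, 0 < β → β < (alphaLow0 Ω s p θΓ xb + t) / p →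
            ∃ δβ : ℝ, 0 < δβ ∧
              ∀ lam : ℝ, 0 < lam → lam < 1 →
                ∃ C : ℝ, ∀ x ∈ Qreg Ω lam (θΓ xb) xb ∩ ball xb δβ,
                  |T u xb - gFun Ω u x| ≤ C * dist xb x ^ β) := by

  classical
  have hS := fun u hu => single_trace p t CΓ δΓ hp ht hCΓ hδΓ0 hδΓ1 Ω hΩo Γ hΓmeas hΓfr θΓ hθm hθ1
    s hs0 hsb lam₀ η₀ hlam₀ hlam₀1 hη₀ hη₀1 H1 ε H2 H3' u hu
  choose F hFm hF using hS
  obtain ⟨b, hbS, hbspan, hli⟩ := exists_linearIndependent ℝ {u : Euc n → ℝ | MemN Ω s p u}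
  let B := Module.Basis.extend hli
  let T : (Euc n → ℝ) →ₗ[ℝ] (Euc n → ℝ) := B.constr ℝ
    (fun v => if h : MemN Ω s p (v : Euc n → ℝ) then F v h else 0)
  have hT : ∀ u ∈ b, ∀ h : MemN Ω s p u, T u = F u h := by
    intro u hu h
    have h1 := B.constr_basis ℝ
      (fun v => if h : MemN Ω s p (v : Euc n → ℝ) then F v h else 0)
      ⟨u, Module.Basis.subset_extend hli hu⟩
    have h2 : B ⟨u, Module.Basis.subset_extend hli hu⟩ = u :=
      Module.Basis.extend_apply_self hli _
    rw [h2] at h1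
    simp only [h, dif_pos] at h1
    exact h1
  have key : ∀ u ∈ Submodule.span ℝ b, IntegrableOn u Ω volume ∧ Measurable (T u) ∧
      TraceProp Ω s p t θΓ Γ u (T u) := by
    intro u hu
    induction hu using Submodule.span_induction with
    | mem u hu =>
      have h : MemN Ω s p u := hbS hu
      rw [hT u hu h]
      exact ⟨h.1, hFm u h, hF u h⟩
    | zero =>
      rw [map_zero]
      exact ⟨integrableOn_zero, measurable_zero, TraceProp.zero hΓmeas⟩
    | add u v _ _ hu hv =>
      rw [map_add]
      exact ⟨hu.1.add hv.1, hu.2.1.add hv.2.1, hu.2.2.add hΩo hu.1 hv.1 hv.2.2⟩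
    | smul a u _ hu =>
      rw [map_smul]
      exact ⟨hu.1.smul a, hu.2.1.const_smul a, hu.2.2.smul a⟩
  have key' : ∀ u : Euc n → ℝ, MemN Ω s p u → IntegrableOn u Ω volume ∧ Measurable (T u) ∧
      TraceProp Ω s p t θΓ Γ u (T u) := fun u hu =>
    key u (by rw [hbspan]; exact Submodule.subset_span hu)
  refine ⟨T, ?_, ?_, fun u hu => (key' u hu).2.1, fun u hu => (key' u hu).2.2⟩
  · intro u v _ _ xb _
    rw [map_add]; rfl
  · intro u a _ xb _
    have : (fun x => a * u x) = a • u := rfl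
    rw [this, map_smul]; rfl
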